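/- Let Γ be a finite simple graph and let H be a subgroup of the right-angled Coxeter group C(Γ) generated by finitely many reflections. Then H is word-quasiconvex: there exists a constant K ≥ 0 such that for every h ∈ H, every word w in the canonical generators representing h of length equal to ℓ(h) (i.e., every geodesic word for h), and every prefix p of w, the element of C(Γ) represented by p lies at distance at most K from H, i.e., there exists h' ∈ H with ℓ(h'⁻¹·(product of p)) ≤ K. -/

import Mathlib

/-- The defining relations of the right-angled Coxeter group of a simple graph:
squares of the generators, and squares of products of generators corresponding to
adjacent vertices. -/
def racgRels {V : Type*} (G : SimpleGraph V) : Set (FreeGroup V) :=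
  {r | (∃ v : V, r = FreeGroup.of v * FreeGroup.of v) ∨
    ∃ u v : V, G.Adj u v ∧ r = (FreeGroup.of u * FreeGroup.of v) ^ 2}

/-- The right-angled Coxeter group of a simple graph. -/
abbrev RACG {V : Type*} (G : SimpleGraph V) : Type _ := PresentedGroup (racgRels G)

/-- The canonical generator of the right-angled Coxeter group corresponding to a vertex. -/
def racgGen {V : Type*} (G : SimpleGraph V) (v : V) : RACG G := PresentedGroup.of v

/-- A reflection of a right-angled Coxeter group: a conjugate of a canonical generator. -/
def IsReflection {V : Type*} (G : SimpleGraph V) (x : RACG G) : Prop :=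
  ∃ (g : RACG G) (v : V), x = g * racgGen G v * g⁻¹

/-- Word length on a right-angled Coxeter group with respect to the canonical generators
(the generators are involutions, so words in the generators suffice). -/
noncomputable def racgLen {V : Type*} (G : SimpleGraph V) (x : RACG G) : ℕ :=
  sInf {n | ∃ l : List V, l.length = n ∧ (l.map (racgGen G)).prod = x}

section RACG

variable {V : Type*} (G : SimpleGraph V)

theorem racgGen_mul_self (v : V) : racgGen G v * racgGen G v = 1 :=
  PresentedGroup.one_of_mem (rels := racgRels G) (Or.inl ⟨v, rfl⟩)

theorem racgGen_inv (v : V) : (racgGen G v)⁻¹ = racgGen G v :=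
  inv_eq_of_mul_eq_one_left (racgGen_mul_self G v)

theorem racgGen_commute {u v : V} (h : G.Adj u v) : Commute (racgGen G u) (racgGen G v) := by
  have h1 : (racgGen G u * racgGen G v) ^ 2 = 1 :=
    PresentedGroup.one_of_mem (rels := racgRels G) (Or.inr ⟨u, v, h, rfl⟩)
  have h2 : racgGen G u * racgGen G v = (racgGen G u * racgGen G v)⁻¹ := by
    rw [eq_inv_iff_mul_eq_one, ← pow_two, h1]
  rwa [mul_inv_rev, racgGen_inv, racgGen_inv] at h2

theorem mul_racgGen_conj {u v : V} (h : G.Adj u v) (x : RACG G) :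
    x * racgGen G u * racgGen G v * (x * racgGen G u)⁻¹ = x * racgGen G v * x⁻¹ := by
  rw [mul_assoc x, (racgGen_commute G h).eq]
  group

theorem mul_racgGen_right_comm {u v : V} (h : G.Adj u v) (x : RACG G) :
    x * racgGen G u * racgGen G v = x * racgGen G v * racgGen G u := by
  rw [mul_assoc, (racgGen_commute G h).eq, mul_assoc]

theorem mul_racgGen_mul_racgGen (x : RACG G) (v : V) : x * racgGen G v * racgGen G v = x := by
  rw [mul_assoc, racgGen_mul_self, mul_one]

theorem mul_inv_mul_racgGen (x : RACG G) (v : V) :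
    x * (x * racgGen G v)⁻¹ = x * racgGen G v * x⁻¹ := by
  rw [mul_inv_rev, racgGen_inv, mul_assoc]

/-- The element of the right-angled Coxeter group represented by a word. -/
def wordProd (l : List V) : RACG G := (l.map (racgGen G)).prod

@[simp] theorem wordProd_nil : wordProd G [] = 1 := rfl

@[simp] theorem wordProd_cons (v : V) (l : List V) :
    wordProd G (v :: l) = racgGen G v * wordProd G l := by simp [wordProd]

@[simp] theorem wordProd_append (l m : List V) :
    wordProd G (l ++ m) = wordProd G l * wordProd G m := by simp [wordProd]

theorem exists_wordProd_eq (x : RACG G) : ∃ l : List V, wordProd G l = x := by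
  have hx : x ∈ Subgroup.closure (Set.range (PresentedGroup.of (rels := racgRels G))) := by
    rw [PresentedGroup.closure_range_of]; trivial
  induction hx using Subgroup.closure_induction with
  | mem x hx =>
    obtain ⟨v, rfl⟩ := hx
    exact ⟨[v], by simp [racgGen]⟩
  | one => exact ⟨[], rfl⟩
  | mul x y _ _ hx hy =>
    obtain ⟨l, rfl⟩ := hx
    obtain ⟨m, rfl⟩ := hy
    exact ⟨l ++ m, wordProd_append G l m⟩
  | inv x _ hx =>
    obtain ⟨l, rfl⟩ := hx
    refine ⟨l.reverse, ?_⟩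
    induction l with
    | nil => simp
    | cons v l ih => simp [ih, racgGen_inv]

theorem racgLen_wordProd_le (l : List V) : racgLen G (wordProd G l) ≤ l.length :=
  Nat.sInf_le ⟨l, rfl, rfl⟩

theorem exists_geodesic_word (x : RACG G) :
    ∃ l : List V, l.length = racgLen G x ∧ wordProd G l = x := by
  obtain ⟨l, hl⟩ := exists_wordProd_eq G x
  exact Nat.sInf_mem (s := {n | ∃ l : List V, l.length = n ∧ (l.map (racgGen G)).prod = x})
    ⟨_, l, rfl, hl⟩

/-- A family of commuting involutions satisfying the defining relations turns a state machine
reading words into a function of the represented group element. -/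
theorem foldl_eq_of_wordProd_eq {X : Type*} (f : X → V → X)
    (hinv : ∀ x v, f (f x v) v = x)
    (hcomm : ∀ x u v, G.Adj u v → f (f x u) v = f (f x v) u)
    {l m : List V} (h : wordProd G l = wordProd G m) (x : X) : l.foldl f x = m.foldl f x := by
  let σ : V → (Equiv.Perm X)ᵐᵒᵖ := fun v =>
    MulOpposite.op ⟨fun x => f x v, fun x => f x v, fun x => hinv x v, fun x => hinv x v⟩
  have hσ : ∀ r ∈ racgRels G, FreeGroup.lift σ r = 1 := by
    rintro r (⟨v, rfl⟩ | ⟨u, v, huv, rfl⟩)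
    · rw [map_mul, FreeGroup.lift_apply_of]
      apply MulOpposite.unop_injective
      ext x
      exact hinv x v
    · rw [map_pow, map_mul, FreeGroup.lift_apply_of, FreeGroup.lift_apply_of, pow_two]
      apply MulOpposite.unop_injective
      ext x
      change f (f (f (f x u) v) u) v = x
      rw [hcomm x u v huv, hinv, hinv]
  let φ : RACG G →* (Equiv.Perm X)ᵐᵒᵖ := PresentedGroup.toGroup hσ
  have hφ : ∀ v, φ (racgGen G v) = σ v := fun v => PresentedGroup.toGroup.of hσ
  have key : ∀ (l : List V) (x : X), l.foldl f x = (φ (wordProd G l)).unop x := by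
    intro l
    induction l with
    | nil => intro x; simp
    | cons v l ih =>
      intro x
      rw [List.foldl_cons, ih, wordProd_cons, map_mul, hφ]
      rfl
  rw [key, key, h]

/-- The reflections whose walls are crossed, in order, by the path from `1` spelled by a word. -/
def reflSeq : List V → List (RACG G)
  | [] => []
  | v :: l => racgGen G v :: (reflSeq l).map (fun q => racgGen G v * q * (racgGen G v)⁻¹)

@[simp] theorem length_reflSeq (l : List V) : (reflSeq G l).length = l.length := by
  induction l with
  | nil => rfl
  | cons v l ih => simp [reflSeq, ih]

theorem mul_mul_inv_injective {A : Type*} [Group A] (g : A) :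
    Function.Injective (fun q : A => g * q * g⁻¹) := by
  intro a b h
  simpa using h

theorem reflSeq_append (l m : List V) :
    reflSeq G (l ++ m) = reflSeq G l ++
      (reflSeq G m).map (fun q => wordProd G l * q * (wordProd G l)⁻¹) := by
  induction l with
  | nil => simp [reflSeq]
  | cons v l ih => simp [reflSeq, ih, mul_assoc]

theorem exists_shorter_word {l : List V} {t : RACG G} (ht : t ∈ reflSeq G l) :
    ∃ m : List V, m.length + 1 = l.length ∧ wordProd G m = t * wordProd G l := by
  induction l generalizing t with
  | nil => simp [reflSeq] at ht
  | cons v l ih =>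
    rw [reflSeq, List.mem_cons, List.mem_map] at ht
    rcases ht with rfl | ⟨q, hq, rfl⟩
    · exact ⟨l, rfl, by rw [wordProd_cons, ← mul_assoc, racgGen_mul_self, one_mul]⟩
    · obtain ⟨m, hm, hp⟩ := ih hq
      exact ⟨v :: m, by simp [hm], by simp [hp, mul_assoc]⟩

theorem racgLen_mul_lt {x t : RACG G} {l : List V} (hl : l.length = racgLen G x)
    (hp : wordProd G l = x) (ht : t ∈ reflSeq G l) : racgLen G (t * x) < racgLen G x := by
  obtain ⟨m, hm, hmp⟩ := exists_shorter_word G ht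
  have := racgLen_wordProd_le G m
  rw [hmp, hp] at this
  omega

theorem nodup_reflSeq {l : List V} (hl : l.length = racgLen G (wordProd G l)) :
    (reflSeq G l).Nodup := by
  induction l with
  | nil => simp [reflSeq]
  | cons v l ih =>
    have hl' : l.length = racgLen G (wordProd G l) := by
      refine le_antisymm ?_ (racgLen_wordProd_le G l)
      obtain ⟨m, hm, hp⟩ := exists_geodesic_word G (wordProd G l)
      have := racgLen_wordProd_le G (v :: m)
      rw [wordProd_cons, hp, ← wordProd_cons, ← hl] at this
      simp at this
      omega
    rw [reflSeq, List.nodup_cons]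
    refine ⟨fun hv => ?_, (ih hl').map (mul_mul_inv_injective _)⟩
    obtain ⟨q, hq, hqv⟩ := List.mem_map.1 hv
    have : q = racgGen G v := by
      have h2 : racgGen G v * q = racgGen G v * racgGen G v := mul_inv_eq_iff_eq_mul.1 hqv
      exact mul_left_cancel h2
    subst this
    have := racgLen_mul_lt G hl' rfl hq
    rw [← wordProd_cons, ← hl, ← hl', List.length_cons] at this
    omega

open Classical in
theorem count_reflSeq_cons (v : V) (l : List V) (t : RACG G) :
    (reflSeq G (v :: l)).count t =
      (reflSeq G l).count ((racgGen G v)⁻¹ * t * racgGen G v) +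
        if racgGen G v = t then 1 else 0 := by
  rw [reflSeq, List.count_cons]
  congr 1
  · have : t = racgGen G v * ((racgGen G v)⁻¹ * t * racgGen G v) * (racgGen G v)⁻¹ := by group
    conv_lhs => rw [this]
    exact List.count_map_of_injective _ _ (mul_mul_inv_injective (racgGen G v)) _
  · simp

open Classical in
/-- The parity of the number of times a path from `1` to `g` crosses the wall of `t`. -/
noncomputable def sidePar (g t : RACG G) : ZMod 2 :=
  ((reflSeq G (exists_wordProd_eq G g).choose).count t : ZMod 2)

theorem mul_mul_inv_eq_iff_eq {A : Type*} [Group A] (x g t : A) :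
    x * g * x⁻¹ = t ↔ g = x⁻¹ * t * x := by
  constructor <;> rintro rfl <;> group

open Classical in
theorem sidePar_wordProd (l : List V) (t : RACG G) :
    sidePar G (wordProd G l) t = ((reflSeq G l).count t : ZMod 2) := by
  let f : RACG G × ZMod 2 → V → RACG G × ZMod 2 := fun s v =>
    (s.1 * racgGen G v, s.2 + if s.1 * racgGen G v * s.1⁻¹ = t then 1 else 0)
  have hf : ∀ (l : List V) (x : RACG G) (a : ZMod 2), l.foldl f (x, a) =
      (x * wordProd G l, a + ((reflSeq G l).count (x⁻¹ * t * x) : ZMod 2)) := by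
    intro l
    induction l with
    | nil => intro x a; simp [reflSeq]
    | cons v l ih =>
      intro x a
      rw [List.foldl_cons, ih, count_reflSeq_cons]
      simp only [wordProd_cons, mul_assoc, mul_inv_rev, Prod.mk.injEq, true_and]
      have := mul_mul_inv_eq_iff_eq x (racgGen G v) t
      simp only [mul_assoc] at this
      simp only [this]
      push_cast
      ring
  have h := foldl_eq_of_wordProd_eq G f ?_ ?_
    (exists_wordProd_eq G (wordProd G l)).choose_spec (1, 0)
  · rw [hf, hf] at h
    simpa [sidePar] using congrArg Prod.snd h
  · rintro ⟨x, a⟩ v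
    simp only [f, mul_assoc, racgGen_mul_self, mul_one, mul_inv_rev, racgGen_inv]
    rw [← mul_assoc (racgGen G v) (racgGen G v), racgGen_mul_self, one_mul, add_assoc,
      CharTwo.add_self_eq_zero, add_zero]
  · rintro ⟨x, a⟩ u v huv
    simp only [f, mul_racgGen_conj G huv, mul_racgGen_conj G huv.symm]
    rw [mul_racgGen_right_comm G huv, add_right_comm]

open Classical in
theorem sidePar_mul (g h t : RACG G) :
    sidePar G (g * h) t = sidePar G g t + sidePar G h (g⁻¹ * t * g) := by
  obtain ⟨l, rfl⟩ := exists_wordProd_eq G g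
  obtain ⟨m, rfl⟩ := exists_wordProd_eq G h
  rw [← wordProd_append, sidePar_wordProd, sidePar_wordProd, sidePar_wordProd, reflSeq_append,
    List.count_append, Nat.cast_add]
  congr 2
  have : t = wordProd G l * ((wordProd G l)⁻¹ * t * wordProd G l) * (wordProd G l)⁻¹ := by group
  conv_lhs => rw [this]
  exact List.count_map_of_injective _ _ (mul_mul_inv_injective (wordProd G l)) _

@[simp] theorem sidePar_one (t : RACG G) : sidePar G 1 t = 0 := by
  classical
  rw [← wordProd_nil, sidePar_wordProd]; simp [reflSeq]

theorem sidePar_inv (g t : RACG G) : sidePar G g⁻¹ t = sidePar G g (g * t * g⁻¹) := by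
  have h := sidePar_mul G g g⁻¹ (g * t * g⁻¹)
  rw [mul_inv_cancel, sidePar_one, eq_comm, CharTwo.add_eq_zero] at h
  rw [h]; congr 1; group

theorem mem_reflSeq_of_sidePar {l : List V} {t : RACG G} (h : sidePar G (wordProd G l) t ≠ 0) :
    t ∈ reflSeq G l := by
  classical
  rw [sidePar_wordProd] at h
  by_contra ht
  exact h (by rw [List.count_eq_zero_of_not_mem ht]; rfl)

theorem sidePar_eq_one_of_mem {l : List V} (hl : l.length = racgLen G (wordProd G l))
    {t : RACG G} (ht : t ∈ reflSeq G l) : sidePar G (wordProd G l) t = 1 := by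
  classical
  rw [sidePar_wordProd, List.count_eq_one_of_mem (nodup_reflSeq G hl) ht, Nat.cast_one]

theorem racgLen_mul_lt_of_sidePar {g t : RACG G} (h : sidePar G g t ≠ 0) :
    racgLen G (t * g) < racgLen G g := by
  obtain ⟨l, hl, rfl⟩ := exists_geodesic_word G g
  exact racgLen_mul_lt G hl rfl (mem_reflSeq_of_sidePar G h)

open Classical in
/-- Between two group elements there is a word crossing the wall of `t` exactly as often
as `t` separates them, simultaneously for all `t`. -/
theorem exists_word_between (x y : RACG G) : ∃ l : List V, x * wordProd G l = y ∧
    ∀ t, (reflSeq G l).count (x⁻¹ * t * x) = if sidePar G x t = sidePar G y t then 0 else 1 := by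
  obtain ⟨l, hl, hp⟩ := exists_geodesic_word G (x⁻¹ * y)
  refine ⟨l, by rw [hp]; group, fun t => ?_⟩
  have hy : sidePar G y t = sidePar G x t + sidePar G (wordProd G l) (x⁻¹ * t * x) := by
    rw [← sidePar_mul, hp, mul_inv_cancel_left]
  simp only [hy, left_eq_add]
  rw [← hp] at hl
  by_cases ht : x⁻¹ * t * x ∈ reflSeq G l
  · rw [List.count_eq_one_of_mem (nodup_reflSeq G hl) ht, sidePar_eq_one_of_mem G hl ht]
    simp
  · rw [List.count_eq_zero_of_not_mem ht, if_pos]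
    by_contra h
    exact ht (mem_reflSeq_of_sidePar G h)

open Classical in
/-- Two reflections whose walls cut the group into four nonempty quadrants commute. -/
theorem commute_of_quadrants {t r x₁ x₂ y₁ y₂ : RACG G}
    (hx : sidePar G x₁ r = sidePar G x₂ r) (hy : sidePar G y₁ r = sidePar G y₂ r)
    (h₁ : sidePar G x₁ t = sidePar G y₁ t) (h₂ : sidePar G x₂ t = sidePar G y₂ t)
    (ht : sidePar G x₁ t ≠ sidePar G x₂ t) (hr : sidePar G x₁ r ≠ sidePar G y₁ r) :
    Commute t r := by
  by_contra hcomm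
  let f : RACG G × ZMod 2 × ZMod 2 → V → RACG G × ZMod 2 × ZMod 2 := fun s v =>
    (s.1 * racgGen G v, s.2.1 + (if s.1 * racgGen G v * s.1⁻¹ = t then 1 else 0),
      s.2.2 + s.2.1 * (if s.1 * racgGen G v * s.1⁻¹ = r then 1 else 0))
  have hfr : ∀ (l : List V) (x : RACG G) (a c : ZMod 2),
      (reflSeq G l).count (x⁻¹ * r * x) = 0 → l.foldl f (x, a, c) =
      (x * wordProd G l, a + ((reflSeq G l).count (x⁻¹ * t * x) : ZMod 2), c) := by
    intro l
    induction l with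
    | nil => intro x a c _; simp [reflSeq]
    | cons v l ih =>
      intro x a c h
      rw [count_reflSeq_cons, Nat.add_eq_zero_iff, ← mul_mul_inv_eq_iff_eq] at h
      rw [List.foldl_cons]
      have h0 : ¬ x * racgGen G v * x⁻¹ = r := by
        intro h'; simp [h'] at h
      simp only [f, h0, if_false, mul_zero, add_zero]
      rw [ih _ _ _ (by simpa [mul_assoc] using h.1), count_reflSeq_cons,
        ← mul_mul_inv_eq_iff_eq]
      simp only [wordProd_cons, mul_assoc, mul_inv_rev, Prod.mk.injEq, true_and, and_true]
      push_cast
      ring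
  have hft : ∀ (l : List V) (x : RACG G) (a c : ZMod 2),
      (reflSeq G l).count (x⁻¹ * t * x) = 0 → l.foldl f (x, a, c) =
      (x * wordProd G l, a, c + a * ((reflSeq G l).count (x⁻¹ * r * x) : ZMod 2)) := by
    intro l
    induction l with
    | nil => intro x a c _; simp [reflSeq]
    | cons v l ih =>
      intro x a c h
      rw [count_reflSeq_cons, Nat.add_eq_zero_iff, ← mul_mul_inv_eq_iff_eq] at h
      rw [List.foldl_cons]
      have h0 : ¬ x * racgGen G v * x⁻¹ = t := by
        intro h'; simp [h'] at h
      simp only [f, h0, if_false, add_zero]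
      rw [ih _ _ _ (by simpa [mul_assoc] using h.1), count_reflSeq_cons,
        ← mul_mul_inv_eq_iff_eq]
      simp only [wordProd_cons, mul_assoc, mul_inv_rev, Prod.mk.injEq, true_and]
      push_cast
      ring
  obtain ⟨l₁, p₁, c₁⟩ := exists_word_between G x₁ x₂
  obtain ⟨l₂, p₂, c₂⟩ := exists_word_between G x₂ y₂
  obtain ⟨l₃, p₃, c₃⟩ := exists_word_between G y₂ y₁
  obtain ⟨l₄, p₄, c₄⟩ := exists_word_between G y₁ x₁
  have hloop : wordProd G (l₁ ++ (l₂ ++ (l₃ ++ l₄))) = wordProd G [] := by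
    apply mul_left_cancel (a := x₁)
    simp only [wordProd_append, wordProd_nil, mul_one]
    simp only [← mul_assoc, p₁, p₂, p₃, p₄]
  have h := foldl_eq_of_wordProd_eq G f ?_ ?_ hloop (x₁, 0, 0)
  · rw [List.foldl_append, List.foldl_append, List.foldl_append,
      hfr l₁ _ _ _ (by rw [c₁, if_pos hx]), p₁,
      hft l₂ _ _ _ (by rw [c₂, if_pos h₂]), p₂,
      hfr l₃ _ _ _ (by rw [c₃, if_pos hy.symm]), p₃,
      hft l₄ _ _ _ (by rw [c₄, if_pos h₁.symm]),
      c₁, c₂, c₃, c₄, if_neg ht, if_neg (by rw [← h₁, ← h₂]; exact ht.symm),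
      if_neg (by rwa [← hx, ← hy]), if_neg hr.symm] at h
    have h' := congrArg (fun s => s.2.2) h
    revert h'
    simp [CharTwo.add_self_eq_zero]
  · rintro ⟨x, a, c⟩ v
    have h1 := mul_racgGen_mul_racgGen G x v
    have h2 := mul_inv_mul_racgGen G x v
    simp only [f, h1, h2]
    by_cases q : x * racgGen G v * x⁻¹ = t
    · have q' : ¬ x * racgGen G v * x⁻¹ = r := by
        rw [q]; rintro rfl; exact hcomm (Commute.refl _)
      rw [if_pos q, if_neg q', add_assoc, CharTwo.add_self_eq_zero]
      simp
    · rw [if_neg q, add_zero, add_zero, add_assoc, CharTwo.add_self_eq_zero, add_zero]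
  · rintro ⟨x, a, c⟩ u v huv
    have hc := racgGen_commute G huv
    have h1 := mul_racgGen_conj G huv x
    have h2 := mul_racgGen_conj G huv.symm x
    have h3 := mul_racgGen_right_comm G huv x
    have hq : Commute (x * racgGen G u * x⁻¹) (x * racgGen G v * x⁻¹) :=
      (Commute.conj_iff x).2 hc
    have e1 : (if x * racgGen G u * x⁻¹ = t then (1 : ZMod 2) else 0) *
        (if x * racgGen G v * x⁻¹ = r then 1 else 0) = 0 := by
      split_ifs with q1 q2
      · exact absurd (q1 ▸ q2 ▸ hq) hcomm
      all_goals simp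
    have e2 : (if x * racgGen G v * x⁻¹ = t then (1 : ZMod 2) else 0) *
        (if x * racgGen G u * x⁻¹ = r then 1 else 0) = 0 := by
      split_ifs with q1 q2
      · exact absurd (q1 ▸ q2 ▸ hq.symm) hcomm
      all_goals simp
    simp only [f, h1, h2]
    rw [h3]
    refine Prod.ext rfl (Prod.ext (add_right_comm _ _ _) ?_)
    simp only [add_mul, e1, e2]
    ring

/-- A nontrivial element of a subgroup generated by reflections is separated from `1` by
the wall of some reflection in the subgroup. -/
theorem exists_mem_sidePar_ne_zero {S : Set (RACG G)} (hS : ∀ x ∈ S, IsReflection G x)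
    {g : RACG G} (hg : g ∈ Subgroup.closure S) (hg1 : g ≠ 1) :
    ∃ r ∈ Subgroup.closure S, sidePar G g r = 1 := by
  classical
  by_contra! hno
  apply hg1
  set H := Subgroup.closure S with hH
  let f : RACG G → V → RACG G := fun d v =>
    if d * racgGen G v * d⁻¹ ∈ H then d else d * racgGen G v
  have hinv : ∀ x v, f (f x v) v = x := by
    intro x v
    by_cases h : x * racgGen G v * x⁻¹ ∈ H
    · simp only [f, if_pos h]
    · have h1 := mul_racgGen_mul_racgGen G x v
      have h2 := mul_inv_mul_racgGen G x v
      simp only [f, if_neg h, h1, h2]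
  have hcomm : ∀ x u v, G.Adj u v → f (f x u) v = f (f x v) u := by
    intro x u v huv
    have h1 := mul_racgGen_conj G huv x
    have h2 := mul_racgGen_conj G huv.symm x
    have h3 := mul_racgGen_right_comm G huv x
    by_cases hu : x * racgGen G u * x⁻¹ ∈ H <;> by_cases hv : x * racgGen G v * x⁻¹ ∈ H <;>
      simp only [f, hu, hv, h1, h2, if_true, if_false]
    exact h3
  have hcoset : ∀ (l : List V) (x : RACG G), ∃ w ∈ H, x * wordProd G l = w * l.foldl f x := by
    intro l
    induction l with
    | nil => intro x; exact ⟨1, H.one_mem, by simp⟩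
    | cons v l ih =>
      intro x
      obtain ⟨w, hw, e⟩ := ih (f x v)
      rw [List.foldl_cons]
      by_cases h : x * racgGen G v * x⁻¹ ∈ H
      · refine ⟨x * racgGen G v * x⁻¹ * w, H.mul_mem h hw, ?_⟩
        rw [mul_assoc _ w, ← e, wordProd_cons]
        simp only [f, if_pos h]
        group
      · refine ⟨w, hw, ?_⟩
        rw [← e, wordProd_cons]
        simp only [f, if_neg h]
        rw [mul_assoc]
  have hfix : ∀ x ∈ H, ∀ l, wordProd G l = x → l.foldl f 1 = 1 := by
    intro x hx
    rw [hH] at hx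
    induction hx using Subgroup.closure_induction with
    | mem x hx =>
      intro l hl
      obtain ⟨g, v, hgv⟩ := hS x hx
      obtain ⟨m, rfl⟩ := exists_wordProd_eq G g
      obtain ⟨m', hm'⟩ := exists_wordProd_eq G (wordProd G m)⁻¹
      obtain ⟨w, hw, e⟩ := hcoset m 1
      rw [one_mul] at e
      have hxH : x ∈ H := Subgroup.subset_closure hx
      have hv : m.foldl f 1 * racgGen G v * (m.foldl f 1)⁻¹ ∈ H := by
        have : m.foldl f 1 * racgGen G v * (m.foldl f 1)⁻¹ = w⁻¹ * x * w := by
          rw [hgv, e]; group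
        rw [this]
        exact H.mul_mem (H.mul_mem (H.inv_mem hw) hxH) hw
      have hl' : wordProd G l = wordProd G (m ++ v :: m') := by
        rw [hl, hgv, wordProd_append, wordProd_cons, hm', mul_assoc]
      have hv' : f (m.foldl f 1) v = m.foldl f 1 := if_pos hv
      rw [foldl_eq_of_wordProd_eq G f hinv hcomm hl', List.foldl_append, List.foldl_cons, hv',
        ← List.foldl_append, foldl_eq_of_wordProd_eq G f hinv hcomm (m := [])
          (by rw [wordProd_append, hm', mul_inv_cancel, wordProd_nil])]
      rfl
    | one =>
      intro l hl
      rw [foldl_eq_of_wordProd_eq G f hinv hcomm (m := []) hl]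
      rfl
    | mul x y _ _ hx hy =>
      intro l hl
      obtain ⟨a, ha⟩ := exists_wordProd_eq G x
      obtain ⟨b, hb⟩ := exists_wordProd_eq G y
      rw [foldl_eq_of_wordProd_eq G f hinv hcomm (m := a ++ b)
        (by rw [hl, wordProd_append, ha, hb]), List.foldl_append, hx a ha, hy b hb]
    | inv x _ hx =>
      intro l hl
      obtain ⟨a, ha⟩ := exists_wordProd_eq G x
      conv_lhs => rw [← hx a ha]
      rw [← List.foldl_append, foldl_eq_of_wordProd_eq G f hinv hcomm (m := [])
        (by rw [wordProd_append, ha, hl, mul_inv_cancel, wordProd_nil])]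
      rfl
  have hmove : ∀ (l : List V) (x : RACG G), (∀ q ∈ reflSeq G l, x * q * x⁻¹ ∉ H) →
      l.foldl f x = x * wordProd G l := by
    intro l
    induction l with
    | nil => intro x _; simp
    | cons v l ih =>
      intro x h
      rw [reflSeq, List.forall_mem_cons] at h
      have hv : f x v = x * racgGen G v := if_neg h.1
      rw [List.foldl_cons, hv, ih, wordProd_cons, mul_assoc]
      intro q hq
      have := h.2 _ (List.mem_map_of_mem hq)
      simpa [mul_assoc] using this
  obtain ⟨l, hl, rfl⟩ := exists_geodesic_word G g
  have h1 := hmove l 1 (fun q hq hqH => hno q (by simpa using hqH)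
    (sidePar_eq_one_of_mem G hl hq))
  rw [hfix _ hg l rfl, one_mul] at h1
  exact h1.symm

/-- If `d` lies in the fundamental chamber of a reflection subgroup and the wall of `t` crosses
both this chamber and its translate by `g`, then `g` commutes with `t`. -/
theorem commute_of_crosses_translate {S : Set (RACG G)} (hS : ∀ x ∈ S, IsReflection G x)
    {d d' t : RACG G} (hd : ∀ r ∈ Subgroup.closure S, sidePar G d r = 0)
    (hd' : ∀ r ∈ Subgroup.closure S, sidePar G d' r = 0)
    (ht : sidePar G d t = 1) {g : RACG G} (hg : g ∈ Subgroup.closure S)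
    (htg : sidePar G d' (g⁻¹ * t * g) = 1) : Commute g t := by
  induction hn : racgLen G g using Nat.strong_induction_on generalizing g with
  | _ n ih =>
    by_cases hg1 : g = 1
    · rw [hg1]; exact Commute.one_left t
    obtain ⟨r, hr, hgr⟩ := exists_mem_sidePar_ne_zero G hS hg hg1
    have hlt : racgLen G (r * g) < racgLen G g :=
      racgLen_mul_lt_of_sidePar G (by rw [hgr]; exact one_ne_zero)
    have hgdr : sidePar G (g * d') r = 1 := by
      rw [sidePar_mul, hgr, hd' _ (mul_mem (mul_mem (inv_mem hg) hr) hg), add_zero]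
    have hgdt : sidePar G (g * d') t = sidePar G g t + 1 := by rw [sidePar_mul, htg]
    have hdr := hd r hr
    have hcomm : Commute t r := by
      have h01 : ∀ a : ZMod 2, a = 0 ∨ a = 1 := by decide
      rcases h01 (sidePar G g t) with h | h
      · apply commute_of_quadrants G (x₁ := 1) (x₂ := d) (y₁ := g) (y₂ := g * d') <;>
          simp [h, hdr, hgr, hgdr, hgdt, ht]
      · have h2 : (1 : ZMod 2) + 1 = 0 := by decide
        apply commute_of_quadrants G (x₁ := 1) (x₂ := d) (y₁ := g * d') (y₂ := g) <;>
          simp [h, hdr, hgr, hgdr, hgdt, ht, h2]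
    have hrg : Commute (r * g) t := by
      refine ih _ (hn ▸ hlt) (mul_mem hr hg) ?_ rfl
      have : (r * g)⁻¹ * t * (r * g) = g⁻¹ * t * g := by
        rw [mul_assoc, ← mul_assoc t, hcomm.eq]; group
      rwa [this]
    have := hcomm.symm.inv_left.mul_left hrg
    rwa [inv_mul_cancel_left] at this

theorem exists_conj_of_sidePar {S : Set (RACG G)} {F : Set (RACG G)}
    (hF : ∀ s ∈ S, ∀ t, sidePar G s t = 1 → t ∈ F) {a : RACG G}
    (ha : a ∈ Subgroup.closure S) {t : RACG G} (ht : sidePar G a t = 1) :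
    ∃ x ∈ Subgroup.closure S, ∃ v ∈ F, t = x * v * x⁻¹ := by
  induction ha using Subgroup.closure_induction generalizing t with
  | mem s hs => exact ⟨1, one_mem _, t, hF s hs t ht, by group⟩
  | one => simp at ht
  | mul a b ha hb iha ihb =>
    have h01 : ∀ a : ZMod 2, a = 0 ∨ a = 1 := by decide
    rcases h01 (sidePar G a t) with h | h
    · rw [sidePar_mul, h, zero_add] at ht
      obtain ⟨x, hx, v, hv, e⟩ := ihb ht
      refine ⟨a * x, mul_mem ha hx, v, hv, ?_⟩
      rw [← (mul_mul_inv_eq_iff_eq a _ t).2 e.symm]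
      group
    · exact iha h
  | inv a ha iha =>
    rw [sidePar_inv] at ht
    obtain ⟨x, hx, v, hv, e⟩ := iha ht
    refine ⟨a⁻¹ * x, mul_mem (inv_mem ha) hx, v, hv, ?_⟩
    have : t = a⁻¹ * (a * t * a⁻¹) * a := by group
    rw [this, e]
    group

/-- A geodesic does not leave and re-enter a half-space. -/
theorem sidePar_take_eq_zero {l : List V} (hl : l.length = racgLen G (wordProd G l)) (i : ℕ)
    {t : RACG G} (ht : sidePar G (wordProd G l) t = 0) :
    sidePar G (wordProd G (l.take i)) t = 0 := by
  by_contra h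
  have hmem : t ∈ reflSeq G l := by
    rw [← List.take_append_drop i l, reflSeq_append]
    exact List.mem_append_left _ (mem_reflSeq_of_sidePar G h)
  rw [sidePar_eq_one_of_mem G hl hmem] at ht
  exact one_ne_zero ht

end RACG

theorem reflection_subgroup_word_quasiconvex {V : Type*} [Fintype V] (Γ : SimpleGraph V)
    (S : Finset (RACG Γ)) (hS : ∀ x ∈ S, IsReflection Γ x) :
    ∃ K : ℕ, ∀ h ∈ Subgroup.closure (S : Set (RACG Γ)),
      ∀ l : List V, (l.map (racgGen Γ)).prod = h → l.length = racgLen Γ h →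
        ∀ i : ℕ, ∃ h' ∈ Subgroup.closure (S : Set (RACG Γ)),
          racgLen Γ (h'⁻¹ * ((l.take i).map (racgGen Γ)).prod) ≤ K := by
  classical
  have hS' : ∀ x ∈ (S : Set (RACG Γ)), IsReflection Γ x := hS
  choose wd hwd using exists_wordProd_eq Γ
  let F : Finset (RACG Γ) := S.biUnion fun s => (reflSeq Γ (wd s)).toFinset
  have hF : ∀ s ∈ (S : Set (RACG Γ)), ∀ t, sidePar Γ s t = 1 → t ∈ (F : Set (RACG Γ)) := by
    intro s hs t ht
    simp only [F, Finset.coe_biUnion, Set.mem_iUnion, List.coe_toFinset, Set.mem_ofPred_eq]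
    refine ⟨s, hs, mem_reflSeq_of_sidePar Γ ?_⟩
    rw [hwd, ht]
    exact one_ne_zero
  refine ⟨F.card, ?_⟩
  intro h hh l hlp hl i
  set H := Subgroup.closure (S : Set (RACG Γ)) with hH
  change wordProd Γ l = h at hlp
  subst hlp
  change ∃ h' ∈ H, racgLen Γ (h'⁻¹ * wordProd Γ (l.take i)) ≤ F.card
  set p := wordProd Γ (l.take i) with hp
  have hex : ∃ n, ∃ h' ∈ H, racgLen Γ (h'⁻¹ * p) = n := ⟨_, 1, one_mem _, rfl⟩
  obtain ⟨h', hh', hlen⟩ := Nat.find_spec hex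
  have hmin : ∀ x ∈ H, racgLen Γ (h'⁻¹ * p) ≤ racgLen Γ (x⁻¹ * p) := fun x hx =>
    hlen ▸ Nat.find_min' hex ⟨x, hx, rfl⟩
  refine ⟨h', hh', ?_⟩
  have h01 : ∀ a : ZMod 2, a = 0 ∨ a = 1 := by decide
  have hd : ∀ r ∈ H, sidePar Γ (h'⁻¹ * p) r = 0 := by
    intro r hr
    by_contra hne
    have h1 := racgLen_mul_lt_of_sidePar Γ hne
    have h2 := hmin (h' * r⁻¹) (mul_mem hh' (inv_mem hr))
    rw [mul_inv_rev, inv_inv, mul_assoc] at h2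
    omega
  obtain ⟨m, hm, hmp⟩ := exists_geodesic_word Γ (h'⁻¹ * p)
  rw [← hmp] at hm hd ⊢
  have hconj : ∀ t ∈ reflSeq Γ m, ∃ v ∈ F, ∃ x ∈ H, t = x * v * x⁻¹ := by
    intro t ht
    have ht1 := sidePar_eq_one_of_mem Γ hm ht
    have hsep : sidePar Γ h'⁻¹ t = 1 ∨ sidePar Γ (h'⁻¹ * wordProd Γ l) t = 1 := by
      by_contra! hcon
      have ha := (h01 _).resolve_right hcon.1
      have hb := (h01 _).resolve_right hcon.2
      rw [sidePar_mul, ha, zero_add] at hb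
      rw [hmp, sidePar_mul, ha, zero_add, hp, sidePar_take_eq_zero Γ hl i hb] at ht1
      exact zero_ne_one ht1
    rcases hsep with hs | hs
    · obtain ⟨x, hx, v, hv, e⟩ := exists_conj_of_sidePar Γ hF (inv_mem hh') hs
      exact ⟨v, hv, x, hx, e⟩
    · obtain ⟨x, hx, v, hv, e⟩ := exists_conj_of_sidePar Γ hF (mul_mem (inv_mem hh') hh) hs
      exact ⟨v, hv, x, hx, e⟩
  choose! φ hφF x hxH hφ using hconj
  have hcard : (reflSeq Γ m).toFinset.card = racgLen Γ (wordProd Γ m) := by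
    rw [List.toFinset_card_of_nodup (nodup_reflSeq Γ hm), length_reflSeq, hm]
  rw [← hcard]
  refine Finset.card_le_card_of_injOn φ (fun t ht => hφF t (by simpa using ht)) ?_
  intro t ht t' ht' he
  rw [Finset.mem_coe, List.mem_toFinset] at ht ht'
  have e1 := hφ t ht
  have e2 := hφ t' ht'
  have hg : x t * (x t')⁻¹ ∈ H := mul_mem (hxH t ht) (inv_mem (hxH t' ht'))
  have e3 : (x t * (x t')⁻¹)⁻¹ * t * (x t * (x t')⁻¹) = t' := by
    have e4 := (mul_mul_inv_eq_iff_eq (x t) (φ t) t).1 e1.symm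
    rw [← he, e4] at e2
    refine Eq.trans ?_ e2.symm
    group
  have hc := commute_of_crosses_translate Γ hS' hd hd (sidePar_eq_one_of_mem Γ hm ht) hg
    (by rw [e3]; exact sidePar_eq_one_of_mem Γ hm ht')
  rw [← e3, mul_assoc, ← hc.eq, inv_mul_cancel_left]
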